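/- Let B be an n×n complex Hermitian positive semi-definite matrix with unit diagonal, L its strictly lower triangular part, ω ∈ (0,2), and Q = I − ω(I + ωL)^{-1}B. Then ℂⁿ is the direct sum of U = Ker(B) and V = (I + ωL)^{-1} Ran(B); both U and V are invariant under Q, and Q restricted to U is the identity. -/

import Mathlib

open Matrix
open scoped ComplexOrder

/-- Spectral (operator ℓ²→ℓ²) norm of a complex square matrix. -/
noncomputable def specNorm {n : ℕ} (M : Matrix (Fin n) (Fin n) ℂ) : ℝ :=
  ‖Matrix.toEuclideanCLM (𝕜 := ℂ) (n := Fin n) M‖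

/-- Strictly lower triangular part of a matrix. -/
def lowerTri {n : ℕ} (M : Matrix (Fin n) (Fin n) ℂ) : Matrix (Fin n) (Fin n) ℂ :=
  Matrix.of fun i j => if j < i then M i j else 0

/-- Squared energy seminorm |y|_B² = ⟨By, y⟩. -/
noncomputable def energySq {n : ℕ} (B : Matrix (Fin n) (Fin n) ℂ) (y : Fin n → ℂ) : ℝ :=
  (star y ⬝ᵥ (B *ᵥ y)).re

/-- Euclidean norm of a vector in ℂⁿ. -/
noncomputable def euclNorm {n : ℕ} (v : Fin n → ℂ) : ℝ :=
  ‖(WithLp.equiv 2 (Fin n → ℂ)).symm v‖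

theorem lowerTri_add_one_add_conjTranspose {n : ℕ} {B : Matrix (Fin n) (Fin n) ℂ}
    (hB : B.IsHermitian) (hdiag : ∀ i, B i i = 1) :
    lowerTri B + 1 + (lowerTri B)ᴴ = B := by
  ext i j
  have hij : star (B j i) = B i j := hB.apply i j
  rcases lt_trichotomy i j with h | rfl | h
  · simp [lowerTri, h, h.ne, h.not_gt, ← hij]
  · simp [lowerTri, hdiag]
  · simp [lowerTri, h, h.ne', h.not_gt]

theorem det_one_add_smul_lowerTri {n : ℕ} (B : Matrix (Fin n) (Fin n) ℂ) (c : ℂ) :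
    (1 + c • lowerTri B).det = 1 := by
  rw [Matrix.det_of_isLowerTriangular]
  · simp [lowerTri]
  · intro i j hij
    have h : i < j := hij
    simp [lowerTri, h.ne, h.not_gt]

/-- The Hermitian part of `1 + ω L` is `(1 - ω / 2) • 1` on the kernel of `B`,
hence definite there when `ω ≠ 2`. -/
theorem eq_zero_of_mulVec_eq_zero_of_dotProduct_eq_zero {n : ℕ}
    {B : Matrix (Fin n) (Fin n) ℂ} (hB : B.IsHermitian) (hdiag : ∀ i, B i i = 1)
    {ω : ℝ} (hω : ω ≠ 2) {v : Fin n → ℂ} (hv : B *ᵥ v = 0)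
    (h : star v ⬝ᵥ ((1 + (ω : ℂ) • lowerTri B) *ᵥ v) = 0) : v = 0 := by
  set W := 1 + (ω : ℂ) • lowerTri B with hW
  have hsum : W + Wᴴ = (2 - ω : ℂ) • 1 + (ω : ℂ) • B := by
    conv_rhs => rw [← lowerTri_add_one_add_conjTranspose hB hdiag]
    rw [hW, conjTranspose_add, conjTranspose_smul, conjTranspose_one, Complex.star_def,
      Complex.conj_ofReal]
    module
  have hstar : star v ⬝ᵥ (Wᴴ *ᵥ v) = 0 := by
    have h' := congrArg star h
    rwa [star_zero, star_dotProduct, star_star, star_mulVec, ← dotProduct_mulVec] at h'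
  have hzero : star v ⬝ᵥ ((W + Wᴴ) *ᵥ v) = 0 := by
    rw [add_mulVec, dotProduct_add, h, hstar, add_zero]
  rw [hsum, add_mulVec, smul_mulVec, smul_mulVec, one_mulVec, hv, smul_zero, add_zero,
    dotProduct_smul, smul_eq_mul, mul_eq_zero] at hzero
  rcases hzero with h2 | h2
  · exact absurd (by exact_mod_cast (sub_eq_zero.mp h2).symm) hω
  · exact dotProduct_star_self_eq_zero.mp h2

/-- ℂⁿ = Ker(B) ⊕ (I+ωL)⁻¹Ran(B); both subspaces are Q-invariant and Q is the
identity on Ker(B). -/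
theorem sor_invariant_decomposition {n : ℕ} (B : Matrix (Fin n) (Fin n) ℂ)
    (hB : B.PosSemidef) (hdiag : ∀ i, B i i = 1)
    (ω : ℝ) (hω0 : 0 < ω) (hω2 : ω < 2)
    (Q : Matrix (Fin n) (Fin n) ℂ)
    (hQ : Q = 1 - (ω : ℂ) • ((1 + (ω : ℂ) • lowerTri B)⁻¹ * B))
    (U V : Submodule ℂ (Fin n → ℂ))
    (hU : U = LinearMap.ker B.mulVecLin)
    (hV : V = (LinearMap.range B.mulVecLin).map
        ((1 + (ω : ℂ) • lowerTri B)⁻¹).mulVecLin) :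
    IsCompl U V ∧ (∀ u ∈ U, Q *ᵥ u = u) ∧ (∀ v ∈ V, Q *ᵥ v ∈ V) := by
  set W := 1 + (ω : ℂ) • lowerTri B with hW
  have hdet : IsUnit W.det := by rw [hW, det_one_add_smul_lowerTri]; exact isUnit_one
  have hinj : Function.Injective (W⁻¹).mulVecLin :=
    mulVec_injective_of_isUnit ((isUnit_nonsing_inv_iff).mpr ((isUnit_iff_isUnit_det W).mpr hdet))
  have hQv (v : Fin n → ℂ) : Q *ᵥ v = v - (ω : ℂ) • W⁻¹ *ᵥ (B *ᵥ v) := by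
    rw [hQ, sub_mulVec, one_mulVec, smul_mulVec, mulVec_mulVec]
  subst hU hV
  refine ⟨(Submodule.isCompl_iff_disjoint _ _ ?_).mpr (Submodule.disjoint_def.mpr ?_), ?_, ?_⟩
  · rw [(Submodule.equivMapOfInjective _ hinj _).finrank_eq.symm, add_comm,
      LinearMap.finrank_range_add_finrank_ker]
  · rintro v hv ⟨_, ⟨x, rfl⟩, rfl⟩
    refine eq_zero_of_mulVec_eq_zero_of_dotProduct_eq_zero hB.isHermitian hdiag hω2.ne hv ?_
    replace hv : B *ᵥ (W⁻¹ *ᵥ (B *ᵥ x)) = 0 := hv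
    simp only [mulVecLin_apply]
    rw [← hW, mulVec_mulVec _ W, mul_nonsing_inv _ hdet, one_mulVec, dotProduct_mulVec,
      ← hB.isHermitian.eq, ← star_mulVec, hB.isHermitian.eq, hv, star_zero, zero_dotProduct]
  · intro u hu
    replace hu : B *ᵥ u = 0 := hu
    rw [hQv, hu, mulVec_zero, smul_zero, sub_zero]
  · intro v hv
    rw [hQv]
    exact Submodule.sub_mem _ hv (Submodule.smul_mem _ _ ⟨_, ⟨v, rfl⟩, rfl⟩)
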